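/- arXiv:2505.07244 — 2 statements merged into one kernel-verified Lean document; each statement's English description precedes it below -/
import Mathlib

section
/- Let τ > 0, T > 0, β > 0 with t* := β·τ ∈ [0,T], and let F : ℝ × 𝒞 → ℝᵐ be weakly nonlinear with constants K > 0, A ≥ 0 and K·τ·e < 1. Let 𝒦₁ ⊆ ℝᵐ be compact and let r₁ > 0. Then there exists a constant C₂ ≥ r₁/2 such that for every y₁ ∈ 𝒦₁ there exists ȳ₁ ∈ ℝᵐ (the limit ȳ₁ = lim_{s→∞} ȳ(s, y(0,c_{y₁})(s))(0)) such that the solution y(0, c_{y₁}) of the DDE with constant initial data c_{y₁} and the special solution ȳ(0, ȳ₁) satisfy ‖y(0,c_{y₁})(t*) − ȳ(0,ȳ₁)(t*)‖∞ < C₂·e^{−β} and ‖y(0,c_{y₁})(T) − ȳ(0,ȳ₁)(T)‖∞ < C₂·e^{−T/τ}. -/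
open Set

noncomputable section

/-- The history space `𝒞 = C([-τ,0], ℝᵐ)` with the sup norm; `ℝᵐ` carries the max norm. -/
abbrev Hist (τ : ℝ) (m : ℕ) : Type := C(Set.Icc (-τ) (0:ℝ), Fin m → ℝ)

/-- The constant history function `c_v ∈ 𝒞`. -/
def histConst {m : ℕ} (τ : ℝ) (v : Fin m → ℝ) : Hist τ m := ContinuousMap.const _ v

-- The history segment `y_t ∈ 𝒞`, defined by `y_t(s) = y(t+s)` for `s ∈ [-τ,0]`
-- (junk value if `y` is not continuous).
open Classical in
def seg {m : ℕ} (τ : ℝ) (y : ℝ → Fin m → ℝ) (t : ℝ) : Hist τ m :=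
  if hy : Continuous y then
    ⟨fun s => y (t + s.1), hy.comp (continuous_const.add continuous_subtype_val)⟩
  else 0

/-- Operator norm of a matrix, induced by the maximum norms. -/
def opNormMax {m n : ℕ} (W : Matrix (Fin m) (Fin n) ℝ) : ℝ :=
  ‖LinearMap.toContinuousLinearMap W.mulVecLin‖

/-- `y` is a (continuous) solution on `[0,T]` of the DDE `y'(t) = F(t, y_t)` with constant
initial data `y ≡ v` on `[-τ,0]` (one-sided derivatives at the endpoints of `[0,T]`). -/
def IsSolOn {m : ℕ} (τ T : ℝ) (F : ℝ → Hist τ m → Fin m → ℝ)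
    (v : Fin m → ℝ) (y : ℝ → Fin m → ℝ) : Prop :=
  Continuous y ∧ (∀ s ∈ Set.Icc (-τ) (0:ℝ), y s = v) ∧
    ∀ t ∈ Set.Icc (0:ℝ) T, HasDerivWithinAt y (F t (seg τ y t)) (Set.Icc (0:ℝ) T) t

/-- `F` is weakly nonlinear with constants `K`, `A`: continuous, `‖F(t,0)‖ ≤ A`, and globally
Lipschitz in the second variable with constant `K`. -/
def WeaklyNonlinear {m : ℕ} (τ : ℝ) (F : ℝ → Hist τ m → Fin m → ℝ) (K A : ℝ) : Prop :=
  Continuous (fun p : ℝ × Hist τ m => F p.1 p.2) ∧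
    (∀ t : ℝ, ‖F t 0‖ ≤ A) ∧
    ∀ (t : ℝ) (u v : Hist τ m), ‖F t u - F t v‖ ≤ K * ‖u - v‖

/-- `y` is a continuous solution of the DDE `y'(t) = F(t, y_t)` on `[t₀ - τ, ∞)` with initial
data `y(t₀ + s) = u(s)` for `s ∈ [-τ, 0]`. -/
def IsGlobalSol {m : ℕ} (τ : ℝ) (F : ℝ → Hist τ m → Fin m → ℝ)
    (t₀ : ℝ) (u : Hist τ m) (y : ℝ → Fin m → ℝ) : Prop :=
  Continuous y ∧ (∀ s : Set.Icc (-τ) (0:ℝ), y (t₀ + s.1) = u s) ∧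
    ∀ t ∈ Set.Ici t₀, HasDerivWithinAt y (F t (seg τ y t)) (Set.Ici t₀) t

/-- A special solution of the DDE `y'(t) = F(t, y_t)`: a (continuously differentiable) solution
defined on all of `ℝ` satisfying the growth condition `sup_t e^{-|t|/τ} ‖y(t)‖ < ∞`. -/
def IsSpecialSol {m : ℕ} (τ : ℝ) (F : ℝ → Hist τ m → Fin m → ℝ) (y : ℝ → Fin m → ℝ) : Prop :=
  Continuous y ∧ (∀ t : ℝ, HasDerivAt y (F t (seg τ y t)) t) ∧
    ∃ C : ℝ, ∀ t : ℝ, Real.exp (-|t| / τ) * ‖y t‖ ≤ C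

/-- A function whose right derivative is bounded by `L e^{λ(t-s)}` on `[s, ∞)` grows at most like
`e^{λ(t-s)}` there. -/
theorem norm_le_exp_of_norm_deriv_right_le {E : Type*} [NormedAddCommGroup E] [NormedSpace ℝ E]
    {f f' : ℝ → E} {s l L : ℝ} (hl : 0 < l) (hf : Continuous f)
    (hf' : ∀ t, s ≤ t → HasDerivWithinAt f (f' t) (Ici t) t)
    (hL : ∀ t, s ≤ t → ‖f' t‖ ≤ L * Real.exp (l * (t - s))) {t : ℝ} (ht : s ≤ t) :
    ‖f t‖ ≤ (‖f s‖ + L / l) * Real.exp (l * (t - s)) := by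
  have hL0 : 0 ≤ L := by
    have h := (norm_nonneg _).trans (hL s le_rfl)
    simpa using h
  have key := image_norm_le_of_norm_deriv_right_le_deriv_boundary (f := f) (f' := f') (a := s)
    (b := t) hf.continuousOn (fun x hx => hf' x hx.1)
    (B := fun x => ‖f s‖ + L / l * (Real.exp (l * (x - s)) - 1))
    (B' := fun x => L * Real.exp (l * (x - s))) (by simp)
    (fun x => by
      have h : HasDerivAt (fun x => l * (x - s)) (l * 1) x :=
        ((hasDerivAt_id x).sub_const s).const_mul l
      exact (((h.exp.sub_const 1).const_mul (L / l)).const_add ‖f s‖).congr_deriv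
        (by field_simp))
    (fun x hx => hL x hx.1) (right_mem_Icc.2 ht)
  have h1 : 1 ≤ Real.exp (l * (t - s)) := Real.one_le_exp (by nlinarith)
  have h2 : 0 ≤ L / l := by positivity
  nlinarith [norm_nonneg (f s)]

/-- Backward version of `norm_le_exp_of_norm_deriv_right_le`. -/
theorem norm_le_exp_of_norm_deriv_left_le {E : Type*} [NormedAddCommGroup E] [NormedSpace ℝ E]
    {f f' : ℝ → E} {s l L : ℝ} (hl : 0 < l) (hf : Continuous f)
    (hf' : ∀ t, t ≤ s → HasDerivWithinAt f (f' t) (Iic t) t)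
    (hL : ∀ t, t ≤ s → ‖f' t‖ ≤ L * Real.exp (l * (s - t))) {t : ℝ} (ht : t ≤ s) :
    ‖f t‖ ≤ (‖f s‖ + L / l) * Real.exp (l * (s - t)) := by
  have key := norm_le_exp_of_norm_deriv_right_le (f := fun u => f (-u)) (f' := fun u => -f' (-u))
    (s := -s) (L := L) hl (hf.comp continuous_neg)
    (fun u hu => by
      have h := (hf' (-u) (by linarith)).scomp u (h := fun v => -v)
        (hasDerivAt_neg u).hasDerivWithinAt (s := Ici u)
        (fun v hv => by simpa using hv)
      simpa [Function.comp_def] using h)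
    (fun u hu => by
      have := hL (-u) (by linarith)
      rw [norm_neg]
      convert this using 4
      ring) (t := -t) (by linarith)
  simp only [neg_neg] at key
  convert key using 4
  ring

/-- Two-sided version of `norm_le_exp_of_norm_deriv_right_le`. -/
theorem norm_le_exp_abs_of_norm_deriv_le {E : Type*} [NormedAddCommGroup E] [NormedSpace ℝ E]
    {f f' : ℝ → E} {s l L : ℝ} (hl : 0 < l) (hf' : ∀ t, HasDerivAt f (f' t) t)
    (hL : ∀ t, ‖f' t‖ ≤ L * Real.exp (l * |t - s|)) (t : ℝ) :
    ‖f t‖ ≤ (‖f s‖ + L / l) * Real.exp (l * |t - s|) := by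
  have hf : Continuous f := continuous_iff_continuousAt.2 fun t => (hf' t).continuousAt
  rcases le_total s t with h | h
  · rw [abs_of_nonneg (sub_nonneg.2 h)]
    refine norm_le_exp_of_norm_deriv_right_le hl hf (fun u _ => (hf' u).hasDerivWithinAt)
      (fun u hu => ?_) h
    simpa [abs_of_nonneg (sub_nonneg.2 hu)] using hL u
  · rw [abs_sub_comm, abs_of_nonneg (sub_nonneg.2 h)]
    refine norm_le_exp_of_norm_deriv_left_le hl hf (fun u _ => (hf' u).hasDerivWithinAt)
      (fun u hu => ?_) h
    simpa [abs_sub_comm u s, abs_of_nonneg (sub_nonneg.2 hu)] using hL u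

/-- If every upper bound `N` of `‖f‖ / w` improves to `P + q N` with `q < 1`, then `P / (1 - q)` is
an upper bound. -/
theorem norm_le_div_of_forall_bound_improves {α E : Type*} [NormedAddCommGroup E] {f : α → E}
    {w : α → ℝ} (hw : ∀ a, 0 < w a) {P q C : ℝ} (hq : q < 1) (hC : ∀ a, ‖f a‖ ≤ C * w a)
    (h : ∀ N, 0 ≤ N → (∀ a, ‖f a‖ ≤ N * w a) → ∀ a, ‖f a‖ ≤ (P + q * N) * w a) (a : α) :
    ‖f a‖ ≤ P / (1 - q) * w a := by
  have : Nonempty α := ⟨a⟩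
  have hbdd : BddAbove (range fun a => ‖f a‖ / w a) :=
    ⟨C, by rintro _ ⟨b, rfl⟩; exact (div_le_iff₀ (hw b)).2 (hC b)⟩
  set N := ⨆ a, ‖f a‖ / w a with hN
  have hle : ∀ b, ‖f b‖ ≤ N * w b := fun b => (div_le_iff₀ (hw b)).1 (le_ciSup hbdd b)
  have hN0 : 0 ≤ N := (div_nonneg (norm_nonneg _) (hw a).le).trans (le_ciSup hbdd a)
  have hNle : N ≤ P + q * N := ciSup_le fun b => (div_le_iff₀ (hw b)).2 (h N hN0 hle b)
  have hNle' : N ≤ P / (1 - q) := (le_div_iff₀ (by linarith)).2 (by linarith)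
  exact (hle a).trans (mul_le_mul_of_nonneg_right hNle' (hw a).le)

theorem seg_apply {m : ℕ} {τ : ℝ} {y : ℝ → Fin m → ℝ} (hy : Continuous y) (t : ℝ)
    (s : Icc (-τ) (0 : ℝ)) : seg τ y t s = y (t + s.1) := by
  simp [seg, hy]

theorem continuous_seg {m : ℕ} {τ : ℝ} {y : ℝ → Fin m → ℝ} (hy : Continuous y) :
    Continuous (seg τ y) := by
  let g : C(ℝ × Icc (-τ) (0 : ℝ), Fin m → ℝ) :=
    ⟨fun p => y (p.1 + p.2.1), hy.comp (continuous_fst.add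
      (continuous_subtype_val.comp continuous_snd))⟩
  have : seg τ y = g.curry := by
    funext t
    ext1 s
    simp [seg_apply hy, g]
  rw [this]
  exact g.curry.continuous

section

variable {m : ℕ} {τ K A : ℝ} {F : ℝ → Hist τ m → Fin m → ℝ}

theorem WeaklyNonlinear.continuous_seg (hF : WeaklyNonlinear τ F K A) {x : ℝ → Fin m → ℝ}
    (hx : Continuous x) : Continuous fun t => F t (seg τ x t) :=
  hF.1.comp (continuous_id.prodMk (_root_.continuous_seg hx))

theorem WeaklyNonlinear.norm_le (hF : WeaklyNonlinear τ F K A) (t : ℝ) (u : Hist τ m) :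
    ‖F t u‖ ≤ A + K * ‖u‖ := by
  have h1 := hF.2.2 t u 0
  rw [sub_zero] at h1
  have h2 := norm_le_norm_add_norm_sub' (F t u) (F t 0)
  have h3 := hF.2.1 t
  linarith

theorem norm_seg_sub_seg_le {x z : ℝ → Fin m → ℝ} (hx : Continuous x) (hz : Continuous z)
    {t c : ℝ} (hc : 0 ≤ c) (h : ∀ r, r ≤ t → t - τ ≤ r → ‖x r - z r‖ ≤ c) :
    ‖seg τ x t - seg τ z t‖ ≤ c := by
  refine (ContinuousMap.norm_le _ hc).2 fun s => ?_
  rw [ContinuousMap.sub_apply, seg_apply hx, seg_apply hz]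
  exact h _ (by linarith [s.2.2]) (by linarith [s.2.1])

theorem norm_seg_sub_seg_le_exp {x z : ℝ → Fin m → ℝ} (hx : Continuous x) (hz : Continuous z)
    {s l N : ℝ} (hl : 0 < l) (hN : 0 ≤ N)
    (h : ∀ r, ‖x r - z r‖ ≤ N * Real.exp (l * |r - s|)) (t : ℝ) :
    ‖seg τ x t - seg τ z t‖ ≤ Real.exp (l * τ) * N * Real.exp (l * |t - s|) := by
  refine norm_seg_sub_seg_le hx hz (by positivity) fun r hr hr' => (h r).trans ?_
  have h1 : |r - s| ≤ τ + |t - s| := by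
    have h2 : |r - t| ≤ τ := abs_le.2 ⟨by linarith, by linarith⟩
    linarith [abs_sub_le r t s]
  calc N * Real.exp (l * |r - s|) ≤ N * Real.exp (l * (τ + |t - s|)) := by gcongr
    _ = _ := by rw [mul_add, Real.exp_add]; ring

/-- Two solutions on `ℝ` with moderate growth stay within a multiple of their distance at `s`. -/
theorem norm_sub_le_of_solutions (hF : WeaklyNonlinear τ F K A) (hK : 0 < K) {l : ℝ} (hl : 0 < l)
    (hKl : K * Real.exp (l * τ) / l < 1) {x z : ℝ → Fin m → ℝ} (hx : Continuous x)
    (hz : Continuous z) (hx' : ∀ t, HasDerivAt x (F t (seg τ x t)) t)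
    (hz' : ∀ t, HasDerivAt z (F t (seg τ z t)) t) {s C : ℝ}
    (hC : ∀ t, ‖x t - z t‖ ≤ C * Real.exp (l * |t - s|)) (t : ℝ) :
    ‖x t - z t‖ ≤ ‖x s - z s‖ / (1 - K * Real.exp (l * τ) / l) * Real.exp (l * |t - s|) := by
  refine norm_le_div_of_forall_bound_improves (f := fun t => x t - z t)
    (w := fun t => Real.exp (l * |t - s|)) (fun _ => Real.exp_pos _) hKl hC
    (fun N hN h r => ?_) t
  have := norm_le_exp_abs_of_norm_deriv_le (f := fun r => x r - z r) (s := s)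
    (L := K * (Real.exp (l * τ) * N)) hl
    (fun u => (hx' u).sub (hz' u)) (fun u => ?_) r
  · convert this using 2
    ring
  · refine (hF.2.2 u _ _).trans ?_
    rw [mul_assoc]
    exact mul_le_mul_of_nonneg_left (norm_seg_sub_seg_le_exp hx hz hl hN h u) hK.le

open BoundedContinuousFunction in
/-- Existence of a solution on `ℝ` of growth `e^{λ|t-s|}` with prescribed value at `s`. -/
theorem exists_solution_through (hF : WeaklyNonlinear τ F K A) (hK : 0 < K) (hA : 0 ≤ A) {l : ℝ}
    (hl : 0 < l) (hKl : K * Real.exp (l * τ) / l < 1) (s : ℝ) (z : Fin m → ℝ) :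
    ∃ x : ℝ → Fin m → ℝ, Continuous x ∧ x s = z ∧ (∀ t, HasDerivAt x (F t (seg τ x t)) t) ∧
      ∃ C, ∀ t, ‖x t‖ ≤ C * Real.exp (l * |t - s|) := by
  let X : (ℝ →ᵇ (Fin m → ℝ)) → ℝ → Fin m → ℝ := fun u t => Real.exp (l * |t - s|) • u t
  have hX : ∀ u, Continuous (X u) := fun u => by fun_prop
  have hXsub : ∀ u v t, ‖X u t - X v t‖ ≤ dist u v * Real.exp (l * |t - s|) := fun u v t => by
    have h : ‖u t - v t‖ ≤ dist u v := by
      rw [← dist_eq_norm]; exact dist_coe_le_dist t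
    rw [← smul_sub, norm_smul, Real.norm_of_nonneg (Real.exp_pos _).le, mul_comm]
    gcongr
  let G : (ℝ →ᵇ (Fin m → ℝ)) → ℝ → Fin m → ℝ :=
    fun u t => z + ∫ r in s..t, F r (seg τ (X u) r)
  have hG : ∀ u t, HasDerivAt (G u) (F t (seg τ (X u) t)) t := fun u t =>
    ((hF.continuous_seg (hX u)).integral_hasStrictDerivAt s t).hasDerivAt.const_add z
  have hGs : ∀ u, G u s = z := fun u => by simp [G]
  have hGc : ∀ u, Continuous (G u) := fun u =>
    continuous_iff_continuousAt.2 fun t => (hG u t).continuousAt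
  have hGsub : ∀ u v t, ‖G u t - G v t‖ ≤
      K * Real.exp (l * τ) / l * dist u v * Real.exp (l * |t - s|) := fun u v t => by
    have := norm_le_exp_abs_of_norm_deriv_le (f := fun r => G u r - G v r) (s := s)
      (L := K * (Real.exp (l * τ) * dist u v)) hl
      (fun r => (hG u r).sub (hG v r)) (fun r => ?_) t
    · convert this using 2
      rw [hGs, hGs, sub_self, norm_zero]
      ring
    · refine (hF.2.2 r _ _).trans ?_
      rw [mul_assoc]
      exact mul_le_mul_of_nonneg_left
        (norm_seg_sub_seg_le_exp (hX u) (hX v) hl dist_nonneg (hXsub u v) r) hK.le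
  have hG0 : ∀ t, ‖G 0 t‖ ≤ (‖z‖ + A / l) * Real.exp (l * |t - s|) := fun t => by
    rw [← hGs 0]
    refine norm_le_exp_abs_of_norm_deriv_le hl (hG 0) (fun r => ?_) t
    have h0 : seg τ (X 0) r = 0 := by
      ext1 θ
      rw [seg_apply (hX 0)]
      simp [X]
    rw [h0]
    exact (hF.2.1 r).trans (le_mul_of_one_le_right hA (Real.one_le_exp (by positivity)))
  have hGb : ∀ u t, ‖Real.exp (-(l * |t - s|)) • G u t‖ ≤
      ‖z‖ + A / l + K * Real.exp (l * τ) / l * dist u 0 := fun u t => by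
    rw [norm_smul, Real.norm_of_nonneg (Real.exp_pos _).le, Real.exp_neg,
      inv_mul_le_iff₀ (Real.exp_pos _)]
    have h1 := norm_le_norm_add_norm_sub' (G u t) (G 0 t)
    have h2 := hG0 t
    have h3 := hGsub u 0 t
    linarith
  let Φ : (ℝ →ᵇ (Fin m → ℝ)) → (ℝ →ᵇ (Fin m → ℝ)) := fun u =>
    ofNormedAddCommGroup (fun t => Real.exp (-(l * |t - s|)) • G u t)
      (by have := hGc u; fun_prop) _ (hGb u)
  have hq : 0 ≤ K * Real.exp (l * τ) / l := by positivity
  have hΦ : ContractingWith ⟨_, hq⟩ Φ := by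
    refine ⟨by exact_mod_cast hKl, LipschitzWith.of_dist_le_mul fun u v => ?_⟩
    refine (dist_le (by positivity)).2 fun t => ?_
    change dist (Real.exp (-(l * |t - s|)) • G u t) (Real.exp (-(l * |t - s|)) • G v t) ≤ _
    rw [dist_eq_norm, ← smul_sub, norm_smul, Real.norm_of_nonneg (Real.exp_pos _).le,
      Real.exp_neg, inv_mul_le_iff₀ (Real.exp_pos _), mul_comm]
    exact hGsub u v t
  have hfix := hΦ.fixedPoint_isFixedPt
  set u := hΦ.fixedPoint
  have hXG : X u = G u := by
    funext t
    have : u t = Real.exp (-(l * |t - s|)) • G u t := by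
      conv_lhs => rw [← hfix]
      rfl
    simp only [X]
    rw [this, smul_smul, ← Real.exp_add, add_neg_cancel, Real.exp_zero, one_smul]
  refine ⟨X u, hX u, by rw [hXG, hGs], fun t => ?_, ‖u‖, fun t => ?_⟩
  · have := hG u t
    rwa [← hXG] at this
  · rw [norm_smul, Real.norm_of_nonneg (Real.exp_pos _).le, mul_comm]
    gcongr
    exact u.norm_coe_le_norm t

theorem IsSpecialSol.norm_le_exp (hτ : 0 < τ) {x : ℝ → Fin m → ℝ} (hx : IsSpecialSol τ F x)
    {l : ℝ} (hl : 1 / τ ≤ l) (s : ℝ) :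
    ∃ C, 0 ≤ C ∧ ∀ t, ‖x t‖ ≤ C * Real.exp (l * |t - s|) := by
  obtain ⟨C, hC⟩ := hx.2.2
  have hC0 : 0 ≤ C := (by positivity : (0 : ℝ) ≤ _).trans (hC 0)
  have hl0 : 0 < l := (by positivity : 0 < 1 / τ).trans_le hl
  refine ⟨C * Real.exp (l * |s|), by positivity, fun t => ?_⟩
  have h1 : ‖x t‖ ≤ C * Real.exp (|t| / τ) := by
    have := hC t
    rwa [neg_div, Real.exp_neg, inv_mul_le_iff₀ (Real.exp_pos _), mul_comm] at this
  refine h1.trans ?_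
  rw [mul_assoc, ← Real.exp_add]
  gcongr
  have h2 : |t| ≤ |s| + |t - s| := by
    have := abs_add_le s (t - s)
    rwa [add_sub_cancel] at this
  calc |t| / τ = 1 / τ * |t| := by ring
    _ ≤ l * |t| := by gcongr
    _ ≤ l * (|s| + |t - s|) := by gcongr
    _ = _ := by ring

theorem IsSpecialSol.norm_sub_le (hF : WeaklyNonlinear τ F K A) (hτ : 0 < τ) (hK : 0 < K)
    {l : ℝ} (hl : 1 / τ ≤ l) (hKl : K * Real.exp (l * τ) / l < 1) {x z : ℝ → Fin m → ℝ}
    (hx : IsSpecialSol τ F x) (hz : IsSpecialSol τ F z) (s t : ℝ) :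
    ‖x t - z t‖ ≤ ‖x s - z s‖ / (1 - K * Real.exp (l * τ) / l) * Real.exp (l * |t - s|) := by
  obtain ⟨C, -, hC⟩ := hx.norm_le_exp hτ hl s
  obtain ⟨D, -, hD⟩ := hz.norm_le_exp hτ hl s
  refine norm_sub_le_of_solutions hF hK ((by positivity : 0 < 1 / τ).trans_le hl) hKl hx.1 hz.1
    hx.2.1 hz.2.1 (C := C + D) (fun r => ?_) t
  rw [add_mul]
  exact (_root_.norm_sub_le _ _).trans (add_le_add (hC r) (hD r))

theorem exists_isSpecialSol (hF : WeaklyNonlinear τ F K A) (hτ : 0 < τ) (hK : 0 < K) (hA : 0 ≤ A)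
    (hsmall : K * Real.exp (1 / τ * τ) / (1 / τ) < 1) (s : ℝ) (z : Fin m → ℝ) :
    ∃ x, IsSpecialSol τ F x ∧ x s = z := by
  obtain ⟨x, hx, hxs, hx', C, hC⟩ :=
    exists_solution_through hF hK hA (by positivity : 0 < 1 / τ) hsmall s z
  have hC0 : 0 ≤ C := by
    have := (norm_nonneg _).trans (hC s)
    simpa using this
  refine ⟨x, ⟨hx, hx', C * Real.exp (|s| / τ), fun t => ?_⟩, hxs⟩
  rw [neg_div, Real.exp_neg, inv_mul_le_iff₀ (Real.exp_pos _)]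
  refine (hC t).trans ?_
  calc C * Real.exp (1 / τ * |t - s|) ≤ C * Real.exp (1 / τ * (|t| + |s|)) := by
        gcongr
        exact abs_sub t s
    _ = _ := by
      rw [mul_add, Real.exp_add]
      ring_nf

/-- A solution with constant initial data `v` at time `0`, continued by `v` to negative times,
stays exponentially close up to time `s` to the special solution that meets it at time `s`. -/
theorem IsGlobalSol.norm_sub_special_le (hF : WeaklyNonlinear τ F K A) (hτ : 0 < τ) (hK : 0 < K)
    (hA : 0 ≤ A) {l : ℝ} (hl : 1 / τ ≤ l) (hKl : K * Real.exp (l * τ) / l < 1) {v : Fin m → ℝ}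
    {y x : ℝ → Fin m → ℝ} (hy : IsGlobalSol τ F 0 (histConst τ v) y) (hx : IsSpecialSol τ F x)
    {s : ℝ} (hs : 0 ≤ s) (hxs : x s = y s) {t : ℝ} (ht : t ≤ s) :
    ‖y (max t 0) - x t‖ ≤
      (A + K * ‖v‖) / l / (1 - K * Real.exp (l * τ) / l) * Real.exp (-(l * t)) := by
  have hl0 : 0 < l := (by positivity : 0 < 1 / τ).trans_le hl
  set B := A + K * ‖v‖ with hBdef
  have hB : 0 ≤ B := by positivity
  let Y : ℝ → Fin m → ℝ := fun t => y (max t 0)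
  have hYc : Continuous Y := hy.1.comp (continuous_id.max continuous_const)
  have hyv : ∀ r, -τ ≤ r → r ≤ 0 → y r = v := fun r h h' => by
    have := hy.2.1 ⟨r, h, h'⟩
    simpa [histConst] using this
  have hY0 : ∀ r, r ≤ 0 → Y r = v := fun r hr => by
    simp only [Y, max_eq_right hr]
    exact hyv 0 (by linarith) le_rfl
  have hYpos : ∀ r, 0 ≤ r → seg τ Y r = seg τ y r := fun r hr => by
    ext1 θ
    rw [seg_apply hYc, seg_apply hy.1]
    rcases le_total (r + θ.1) 0 with h | h
    · rw [hY0 _ h, hyv _ (by linarith [θ.2.1]) h]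
    · simp only [Y, max_eq_left h]
  have hYneg : ∀ r, r ≤ 0 → seg τ Y r = histConst τ v := fun r hr => by
    ext1 θ
    rw [seg_apply hYc, hY0 _ (by linarith [θ.2.2])]
    rfl
  let Y' : ℝ → Fin m → ℝ := fun r => if r ≤ 0 then 0 else F r (seg τ Y r)
  have hY' : ∀ r, HasDerivWithinAt Y (Y' r) (Iic r) r := fun r => by
    by_cases hr : r ≤ 0
    · simp only [Y', hr, if_true]
      exact (hasDerivWithinAt_const r (Iic r) v).congr
        (fun q hq => hY0 q (le_trans hq hr)) (hY0 r hr)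
    · simp only [Y', hr, if_false]
      push Not at hr
      rw [hYpos r hr.le]
      have h := (hy.2.2 r hr.le).hasDerivAt (Ici_mem_nhds hr)
      refine (h.congr_of_eventuallyEq ?_).hasDerivWithinAt
      filter_upwards [Ici_mem_nhds hr] with q hq
      simp only [Y, max_eq_left (mem_Ici.1 hq)]
  have hYF : ∀ r, ‖Y' r - F r (seg τ Y r)‖ ≤ B * Real.exp (-(l * r)) := fun r => by
    by_cases hr : r ≤ 0
    · simp only [Y', hr, if_true, zero_sub, norm_neg]
      have h1 : ‖F r (seg τ Y r)‖ ≤ B := by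
        refine (hF.norm_le r _).trans ?_
        rw [hYneg r hr, hBdef]
        gcongr
        exact (ContinuousMap.norm_le _ (norm_nonneg _)).2 fun _ => le_rfl
      exact h1.trans (le_mul_of_one_le_right hB (Real.one_le_exp (by nlinarith)))
    · simp only [Y', hr, if_false, sub_self, norm_zero]
      positivity
  obtain ⟨C, hC0, hC⟩ := hx.norm_le_exp hτ hl s
  obtain ⟨D, hD⟩ := (isCompact_Icc (a := (0 : ℝ)) (b := s)).exists_bound_of_continuousOn
    hy.1.continuousOn
  have hmain := norm_le_div_of_forall_bound_improves (α := Iic s) (f := fun r => Y r - x r)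
    (w := fun r => Real.exp (l * (s - r))) (fun _ => Real.exp_pos _)
    (P := B / l * Real.exp (-(l * s))) (q := K * Real.exp (l * τ) / l) (C := D + C) hKl
    (fun r => ?_) (fun N hN h r => ?_) ⟨t, ht⟩
  · refine hmain.trans (le_of_eq ?_)
    have : Real.exp (-(l * t)) = Real.exp (-(l * s)) * Real.exp (l * (s - t)) := by
      rw [← Real.exp_add]; ring_nf
    rw [this]
    ring
  · have hr : r.1 ≤ s := r.2
    have h1 := hD (max r.1 0) ⟨le_max_right _ _, max_le hr hs⟩
    have h2 := hC r
    rw [abs_sub_comm, abs_of_nonneg (sub_nonneg.2 hr)] at h2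
    have h3 : 1 ≤ Real.exp (l * (s - r)) :=
      Real.one_le_exp (mul_nonneg hl0.le (sub_nonneg.2 hr))
    have h4 : 0 ≤ D := (norm_nonneg _).trans h1
    have h5 := _root_.norm_sub_le (Y r) (x r)
    change ‖Y r‖ ≤ D at h1
    nlinarith
  · have key := norm_le_exp_of_norm_deriv_left_le (s := s) (f := fun r => Y r - x r)
      (L := K * Real.exp (l * τ) * N + B * Real.exp (-(l * s))) hl0
      (hYc.sub hx.1) (fun q _ => (hY' q).sub (hx.2.1 q).hasDerivWithinAt) (fun q hq => ?_) r.2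
    · refine key.trans (le_of_eq ?_)
      have hYs : Y s - x s = 0 := by
        rw [hxs]
        simp only [Y, max_eq_left hs, sub_self]
      rw [hYs, norm_zero]
      ring
    · have h1 := hF.2.2 q (seg τ Y q) (seg τ x q)
      have h2 : ‖seg τ Y q - seg τ x q‖ ≤ N * Real.exp (l * (s - q + τ)) := by
        refine norm_seg_sub_seg_le hYc hx.1 (by positivity) fun p hp hp' => ?_
        refine (h ⟨p, hp.trans hq⟩).trans ?_
        have : s - p ≤ s - q + τ := by linarith
        gcongr
      have h3 : Real.exp (l * (s - q + τ)) = Real.exp (l * τ) * Real.exp (l * (s - q)) := by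
        rw [← Real.exp_add]; ring_nf
      have h4 : Real.exp (-(l * q)) = Real.exp (-(l * s)) * Real.exp (l * (s - q)) := by
        rw [← Real.exp_add]; ring_nf
      have h5 := hYF q
      have h6 := norm_sub_le_norm_sub_add_norm_sub (Y' q) (F q (seg τ Y q)) (F q (seg τ x q))
      rw [h3] at h2
      rw [h4] at h5
      have h7 := mul_le_mul_of_nonneg_left h2 hK.le
      refine h6.trans ((add_le_add h5 (h1.trans h7)).trans (le_of_eq ?_))
      ring

/-- If `Kτe < 1`, some rate strictly larger than `1/τ` is still admissible. -/
theorem exists_rate_gt (hτ : 0 < τ) (hsmall : K * Real.exp (1 / τ * τ) / (1 / τ) < 1) :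
    ∃ l, 1 / τ < l ∧ K * Real.exp (l * τ) / l < 1 := by
  have hc : ContinuousAt (fun l : ℝ => K * Real.exp (l * τ) / l) (1 / τ) :=
    ContinuousAt.div (by fun_prop) continuousAt_id (by positivity)
  have h : ∀ᶠ l in nhdsWithin (1 / τ) (Ioi (1 / τ)), K * Real.exp (l * τ) / l < 1 :=
    (hc.eventually_lt_const hsmall).filter_mono nhdsWithin_le_nhds
  obtain ⟨l, h1, h2⟩ := (h.and self_mem_nhdsWithin).exists
  exact ⟨l, h2, h1⟩

/-- A solution with constant initial data is attracted, at any admissible rate `l > 1/τ`, by the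
special solution through the limit of the values at `0` of the special solutions meeting it. -/
theorem IsGlobalSol.exists_attracting_special (hF : WeaklyNonlinear τ F K A) (hτ : 0 < τ)
    (hK : 0 < K) (hA : 0 ≤ A) (hsmall : K * Real.exp (1 / τ * τ) / (1 / τ) < 1) {l : ℝ}
    (hl : 1 / τ < l) (hKl : K * Real.exp (l * τ) / l < 1) {v : Fin m → ℝ} {y : ℝ → Fin m → ℝ}
    (hy : IsGlobalSol τ F 0 (histConst τ v) y) :
    ∃ x, IsSpecialSol τ F x ∧
      (∀ Y : ℝ → ℝ → Fin m → ℝ, (∀ s, IsSpecialSol τ F (Y s) ∧ Y s s = y s) →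
        Filter.Tendsto (fun s => Y s 0) Filter.atTop (nhds (x 0))) ∧
      ∀ t, 0 ≤ t → ‖y t - x t‖ ≤
        (A + K * ‖v‖) / l / (1 - K * Real.exp (l * τ) / l) * Real.exp (-(l * t)) := by
  set M := (A + K * ‖v‖) / l / (1 - K * Real.exp (l * τ) / l) with hM
  set q := K * Real.exp (1 / τ * τ) / (1 / τ)
  have hq : 0 < 1 - q := by linarith
  have hl0 : 0 < l := (by positivity : 0 < 1 / τ).trans hl
  have hM0 : 0 ≤ M := div_nonneg (by positivity) (by linarith)
  choose X hX hXs using fun s => exists_isSpecialSol hF hτ hK hA hsmall s (y s)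
  have hyX : ∀ s t, 0 ≤ t → t ≤ s → ‖y t - X s t‖ ≤ M * Real.exp (-(l * t)) :=
    fun s t ht hts => by
      have := hy.norm_sub_special_le hF hτ hK hA hl.le hKl (hX s) (ht.trans hts) (hXs s) hts
      rwa [max_eq_left ht] at this
  have hstep : ∀ s s', 0 ≤ s → s ≤ s' →
      dist (X s 0) (X s' 0) ≤ M / (1 - q) * Real.exp (-((l - 1 / τ) * s)) := fun s s' hs hss' => by
    rw [dist_eq_norm]
    refine ((hX s).norm_sub_le hF hτ hK le_rfl hsmall (hX s') s 0).trans ?_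
    rw [hXs s, zero_sub, abs_neg, abs_of_nonneg hs]
    have h1 := hyX s' s hs hss'
    calc _ ≤ M * Real.exp (-(l * s)) / (1 - q) * Real.exp (1 / τ * s) := by gcongr
      _ = M / (1 - q) * (Real.exp (-(l * s)) * Real.exp (1 / τ * s)) := by ring
      _ = _ := by rw [← Real.exp_add]; ring_nf
  have hcauchy : CauchySeq fun s : ℝ => X (max s 0) 0 := by
    refine cauchySeq_of_le_tendsto_0 (fun s => M / (1 - q) * Real.exp (-((l - 1 / τ) * s))) ?_ ?_
    · have hwlog : ∀ a b N : ℝ, N ≤ a → a ≤ b → dist (X (max a 0) 0) (X (max b 0) 0) ≤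
          M / (1 - q) * Real.exp (-((l - 1 / τ) * N)) := fun a b N hN hab => by
        refine (hstep _ _ (le_max_right _ _) (max_le_max hab le_rfl)).trans ?_
        have h1 : N ≤ max a 0 := hN.trans (le_max_left _ _)
        have h2 : 0 ≤ l - 1 / τ := by linarith
        gcongr
      intro a b N ha hb
      rcases le_total a b with h | h
      · exact hwlog a b N ha h
      · rw [dist_comm]
        exact hwlog b a N hb h
    · have h1 : Filter.Tendsto (fun s => (l - 1 / τ) * s) Filter.atTop Filter.atTop :=
        Filter.tendsto_id.const_mul_atTop (sub_pos.2 hl)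
      have h2 := (Real.tendsto_exp_neg_atTop_nhds_zero.comp h1).const_mul (M / (1 - q))
      simpa [Function.comp_def] using h2
  obtain ⟨p, hp⟩ := cauchySeq_tendsto_of_complete hcauchy
  have hp' : Filter.Tendsto (fun s => X s 0) Filter.atTop (nhds p) := by
    refine hp.congr' ?_
    filter_upwards [Filter.eventually_ge_atTop 0] with s hs
    rw [max_eq_left hs]
  obtain ⟨x, hx, hx0⟩ := exists_isSpecialSol hF hτ hK hA hsmall 0 p
  refine ⟨x, hx, fun Y hY => ?_, fun t ht => ?_⟩
  · rw [hx0]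
    refine hp'.congr fun s => ?_
    have := (hX s).norm_sub_le hF hτ hK le_rfl hsmall (hY s).1 s 0
    rw [hXs s, (hY s).2, sub_self, norm_zero, zero_div, zero_mul] at this
    exact sub_eq_zero.1 (norm_le_zero_iff.1 this)
  · have hlim : Filter.Tendsto (fun s => M * Real.exp (-(l * t)) +
        ‖X s 0 - p‖ / (1 - q) * Real.exp (1 / τ * |t - 0|)) Filter.atTop
        (nhds (M * Real.exp (-(l * t)) + 0 / (1 - q) * Real.exp (1 / τ * |t - 0|))) :=
      (((tendsto_iff_norm_sub_tendsto_zero.1 hp').div_const _).mul_const _).const_add _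
    rw [zero_div, zero_mul, add_zero] at hlim
    refine ge_of_tendsto hlim ?_
    filter_upwards [Filter.eventually_ge_atTop t] with s hs
    have h1 := (hX s).norm_sub_le hF hτ hK le_rfl hsmall hx 0 t
    rw [hx0] at h1
    exact (norm_sub_le_norm_sub_add_norm_sub _ (X s t) _).trans
      (add_le_add (hyX s t ht hs) h1)

end

/-- Exponential attraction on a compact set of initial values: there is
`C₂ ≥ r₁/2` such that for every `y₁ ∈ 𝒦₁`, the solution with constant initial data `c_{y₁}`
is within `C₂·e^{-β}` of its attracting special solution at time `t* = β·τ` and within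
`C₂·e^{-T/τ}` at time `T`. -/
theorem exponential_attraction_on_compact
    {m : ℕ} (τ T β : ℝ) (hτ : 0 < τ) (hT : 0 < T) (hβ : 0 < β)
    (htstar : β * τ ∈ Set.Icc (0:ℝ) T)
    (F : ℝ → Hist τ m → Fin m → ℝ) (K A : ℝ) (hK : 0 < K) (hA : 0 ≤ A)
    (hF : WeaklyNonlinear τ F K A) (hsmall : K * τ * Real.exp 1 < 1)
    (Kset : Set (Fin m → ℝ)) (hKset : IsCompact Kset) (r₁ : ℝ) (hr₁ : 0 < r₁) :
    ∃ C₂ : ℝ, r₁ / 2 ≤ C₂ ∧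
      ∀ y₁ ∈ Kset, ∀ y : ℝ → Fin m → ℝ, IsGlobalSol τ F 0 (histConst τ y₁) y →
        ∃ (ybar₁ : Fin m → ℝ) (ybar : ℝ → Fin m → ℝ),
          IsSpecialSol τ F ybar ∧ ybar 0 = ybar₁ ∧
          (∀ Y : ℝ → ℝ → Fin m → ℝ,
            (∀ s : ℝ, IsSpecialSol τ F (Y s) ∧ Y s s = y s) →
            Filter.Tendsto (fun s => Y s 0) Filter.atTop (nhds ybar₁)) ∧
          ‖y (β * τ) - ybar (β * τ)‖ < C₂ * Real.exp (-β) ∧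
          ‖y T - ybar T‖ < C₂ * Real.exp (-(T / τ)) := by
  have hsmall' : K * Real.exp (1 / τ * τ) / (1 / τ) < 1 := by
    rw [one_div_mul_cancel hτ.ne', div_div_eq_mul_div, div_one]
    linarith
  obtain ⟨l, hl, hKl⟩ := exists_rate_gt hτ hsmall'
  obtain ⟨R, hR⟩ := hKset.isBounded.exists_norm_le
  have hl0 : 0 < l := (by positivity : 0 < 1 / τ).trans hl
  have hq : 0 < 1 - K * Real.exp (l * τ) / l := by linarith
  set M := (A + K * R) / l / (1 - K * Real.exp (l * τ) / l)
  refine ⟨max (r₁ / 2) (M + 1), le_max_left _ _, fun y₁ hy₁ y hy => ?_⟩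
  obtain ⟨x, hx, hlim, hbound⟩ := hy.exists_attracting_special hF hτ hK hA hsmall' hl hKl
  have hlt : ∀ t, 0 ≤ t → ‖y t - x t‖ < max (r₁ / 2) (M + 1) * Real.exp (-(t / τ)) :=
    fun t ht => by
      have h1 : (A + K * ‖y₁‖) / l / (1 - K * Real.exp (l * τ) / l) ≤ M := by
        have := hR y₁ hy₁
        simp only [M]
        gcongr
      have h2 : t / τ ≤ l * t := by
        rw [div_eq_mul_one_div, mul_comm]
        gcongr
      have h3 : 0 ≤ (A + K * ‖y₁‖) / l / (1 - K * Real.exp (l * τ) / l) := by positivity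
      calc ‖y t - x t‖ ≤ _ := hbound t ht
        _ ≤ M * Real.exp (-(t / τ)) := by
          have := h3.trans h1
          gcongr
        _ < _ := by
          gcongr
          exact (lt_add_one M).trans_le (le_max_right _ _)
  refine ⟨x 0, x, hx, rfl, hlim, ?_, hlt T hT.le⟩
  have := hlt (β * τ) htstar.1
  rwa [mul_div_cancel_right₀ β hτ.ne'] at this
end
end

section
/- Let K₀ ∈ ℝ and τ > 0 with |K₀|·τ·e < 1. Then: (i) there exists a unique λ₁ ∈ (−1/τ, 1/τ) satisfying the characteristic equation λ₁ = K₀·e^{−λ₁τ}; and (ii) for every (t₀, y₀) ∈ ℝ × ℝ, the function y(t) = y₀·e^{λ₁(t−t₀)} is a special solution of the scalar linear delay differential equation y′(t) = K₀·y(t−τ): it is defined and continuously differentiable on all of ℝ, satisfies y′(t) = K₀·y(t−τ) for all t ∈ ℝ, satisfies y(t₀) = y₀, and fulfills the growth condition sup_{t∈ℝ} e^{−|t|/τ}·|y(t)| < ∞. -/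
open Set

noncomputable section

/-- On `(-1/τ, ∞)` the map `x ↦ K₀ e^{-xτ}` increases strictly slower than the identity. -/
theorem mul_exp_sub_lt_sub {K₀ τ a b : ℝ} (hτ : 0 < τ) (hsmall : |K₀| * τ * Real.exp 1 < 1)
    (ha : -(1 / τ) < a) (hab : a < b) :
    K₀ * Real.exp (-(b * τ)) - K₀ * Real.exp (-(a * τ)) < b - a := by
  have haτ : -(a * τ) ≤ 1 := by
    have h := mul_lt_mul_of_pos_right ha hτ
    have : -(1 / τ) * τ = -1 := by field_simp
    linarith
  have hexp : Real.exp (-(a * τ)) ≤ Real.exp 1 := Real.exp_le_exp.2 haτ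
  have hsplit : Real.exp (-(b * τ)) = Real.exp (-(a * τ)) * Real.exp (-((b - a) * τ)) := by
    rw [← Real.exp_add]
    ring_nf
  have hbaτ : 0 < (b - a) * τ := mul_pos (sub_pos.2 hab) hτ
  have hle : 1 - Real.exp (-((b - a) * τ)) ≤ (b - a) * τ := by
    linarith [Real.add_one_le_exp (-((b - a) * τ))]
  have hnonneg : 0 ≤ 1 - Real.exp (-((b - a) * τ)) :=
    sub_nonneg.2 (Real.exp_le_one_iff.2 (by linarith))
  calc K₀ * Real.exp (-(b * τ)) - K₀ * Real.exp (-(a * τ))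
      = -K₀ * (Real.exp (-(a * τ)) * (1 - Real.exp (-((b - a) * τ)))) := by
        rw [hsplit]
        ring
    _ ≤ |K₀| * (Real.exp 1 * ((b - a) * τ)) := by
        gcongr
        exact neg_le_abs K₀
    _ = |K₀| * τ * Real.exp 1 * (b - a) := by ring
    _ < b - a := mul_lt_of_lt_one_left (sub_pos.2 hab) hsmall

/-- The characteristic equation `x = K₀ e^{-xτ}` has a solution in `(-1/τ, 1/τ)`. -/
theorem exists_eq_mul_exp_neg {K₀ τ : ℝ} (hτ : 0 < τ) (hsmall : |K₀| * τ * Real.exp 1 < 1) :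
    ∃ x ∈ Ioo (-(1 / τ)) (1 / τ), x = K₀ * Real.exp (-(x * τ)) := by
  have hK : |K₀| * Real.exp 1 < 1 / τ := by
    rw [lt_div_iff₀ hτ]
    linarith
  have hpos : 0 < 1 / τ := by positivity
  have hcancel : 1 / τ * τ = 1 := by field_simp
  have hleft : -(1 / τ) - K₀ * Real.exp (-(-(1 / τ) * τ)) < 0 := by
    rw [neg_mul, neg_neg, hcancel]
    have := mul_le_mul_of_nonneg_right (neg_abs_le K₀) (Real.exp_pos 1).le
    linarith
  have hright : 0 < 1 / τ - K₀ * Real.exp (-(1 / τ * τ)) := by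
    rw [hcancel]
    have h : K₀ * Real.exp (-1) ≤ |K₀| * Real.exp 1 := by
      gcongr
      · exact le_abs_self K₀
      · norm_num
    linarith
  have hcont : ContinuousOn (fun x : ℝ => x - K₀ * Real.exp (-(x * τ)))
      (Icc (-(1 / τ)) (1 / τ)) := by fun_prop
  obtain ⟨x, hx, hx0⟩ := intermediate_value_Ioo (by linarith) hcont ⟨hleft, hright⟩
  exact ⟨x, hx, sub_eq_zero.1 hx0⟩

/-- An exponential of rate at most `1/τ` in absolute value grows no faster than `e^{|t|/τ}`. -/
theorem exp_neg_abs_div_mul_abs_le {τ x : ℝ} (hx : |x| ≤ 1 / τ) (t₀ y₀ t : ℝ) :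
    Real.exp (-|t| / τ) * |y₀ * Real.exp (x * (t - t₀))| ≤ |y₀| * Real.exp (-(x * t₀)) := by
  have hxt : x * t ≤ |t| / τ := calc
    x * t ≤ |x| * |t| := (le_abs_self _).trans (abs_mul x t).le
    _ ≤ 1 / τ * |t| := by gcongr
    _ = |t| / τ := by ring
  rw [abs_mul, Real.abs_exp, mul_left_comm, ← Real.exp_add]
  gcongr
  rw [neg_div]
  linarith

/-- For the scalar linear DDE `y'(t) = K₀ y(t-τ)` with `|K₀|·τ·e < 1`:
(i) the characteristic equation `λ = K₀ e^{-λτ}` has a unique solution `λ₁ ∈ (-1/τ, 1/τ)`;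
(ii) for every `(t₀, y₀)`, the function `y(t) = y₀ e^{λ₁ (t - t₀)}` is a special solution:
it is defined on all of `ℝ`, satisfies the DDE for all `t`, satisfies `y(t₀) = y₀`, and
fulfills the growth condition `sup_t e^{-|t|/τ} |y(t)| < ∞`. -/
theorem scalar_linear_DDE_special_solution
    (K₀ τ : ℝ) (hτ : 0 < τ) (hsmall : |K₀| * τ * Real.exp 1 < 1) :
    ∃ lambda1 : ℝ,
      (-(1/τ) < lambda1 ∧ lambda1 < 1/τ ∧ lambda1 = K₀ * Real.exp (-(lambda1 * τ))) ∧
      (∀ μ : ℝ, -(1/τ) < μ → μ < 1/τ → μ = K₀ * Real.exp (-(μ * τ)) → μ = lambda1) ∧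
      ∀ t₀ y₀ : ℝ,
        (∀ t : ℝ, HasDerivAt (fun s => y₀ * Real.exp (lambda1 * (s - t₀)))
          (K₀ * (y₀ * Real.exp (lambda1 * ((t - τ) - t₀)))) t) ∧
        y₀ * Real.exp (lambda1 * (t₀ - t₀)) = y₀ ∧
        ∃ C : ℝ, ∀ t : ℝ, Real.exp (-|t| / τ) * |y₀ * Real.exp (lambda1 * (t - t₀))| ≤ C := by
  obtain ⟨x, ⟨hx1, hx2⟩, hx⟩ := exists_eq_mul_exp_neg hτ hsmall
  refine ⟨x, ⟨hx1, hx2, hx⟩, fun μ hμ1 _ hμ => ?_, fun t₀ y₀ => ⟨fun t => ?_, by simp, ?_⟩⟩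
  · rcases lt_trichotomy μ x with h | h | h
    · linarith [mul_exp_sub_lt_sub hτ hsmall hμ1 h]
    · exact h
    · linarith [mul_exp_sub_lt_sub hτ hsmall hx1 h]
  · have hderiv : HasDerivAt (fun s => y₀ * Real.exp (x * (s - t₀)))
        (y₀ * (Real.exp (x * (t - t₀)) * (x * 1))) t :=
      ((((hasDerivAt_id t).sub_const t₀).const_mul x).exp).const_mul y₀
    have hsplit : Real.exp (x * (t - τ - t₀)) =
        Real.exp (x * (t - t₀)) * Real.exp (-(x * τ)) := by
      rw [← Real.exp_add]
      ring_nf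
    convert hderiv using 1
    rw [hsplit]
    linear_combination -(y₀ * Real.exp (x * (t - t₀))) * hx
  · exact ⟨_, exp_neg_abs_div_mul_abs_le (abs_le.2 ⟨hx1.le, hx2.le⟩) t₀ y₀⟩
end
end
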